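/- Fix u > 0 and set t := (1 + u²)^{−1/2}. Then, as ν → ∞ along the positive reals, (u / (2√(1 + u²))) · [ I_{ν+1/2}(νu) / I_{ν−1/2}(νu) + I_{ν−1/2}(νu) / I_{ν+1/2}(νu) ] = 1 + (1/ν) · (t³/2) + (1/ν²) · (5/8) t⁴ (1 − t²) + (1/ν³) · t⁵ ( 1 − (23/8) t² + (15/8) t⁴ ) + O(ν^{−4}). Equivalently, for θ ≠ 0 the function P_ν(θ, νu) := (1/(2 sinh θ)) [ I_{ν+1/2}(νu)/I_{ν−1/2}(νu) + I_{ν−1/2}(νu)/I_{ν+1/2}(νu) ] satisfies P_ν(θ, νu) = b (1 + δ(ν)) with b = √(1+u²)/(u sinh θ) and δ(ν) = t³/(2ν) + (5/8)t⁴(1−t²)/ν² + t⁵(1 − (23/8)t² + (15/8)t⁴)/ν³ + O(ν^{−4}). -/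

import Mathlib

open Filter

/-- Modified Bessel function of the first kind of real order `μ` (for `x > 0`), defined
by its power series `I_μ(x) = ∑_k (x/2)^{μ+2k}/(k! Γ(μ+k+1))` with real powers. -/
noncomputable def besselI (μ : ℝ) (x : ℝ) : ℝ :=
  ∑' k : ℕ, (x / 2) ^ (μ + 2 * (k : ℝ)) / ((k.factorial : ℝ) * Real.Gamma (μ + k + 1))

/-- The entire function `∑ z^k / (k! Γ(μ+k+1))`, so that `I_μ(x) = (x/2)^μ Φ_μ(x²/4)`. -/
noncomputable def besselEntire (μ z : ℝ) : ℝ :=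
  ∑' k : ℕ, z ^ k / ((k.factorial : ℝ) * Real.Gamma (μ + k + 1))

lemma Gamma_le_Gamma_add_nat {μ : ℝ} (hμ : 0 ≤ μ) (k : ℕ) :
    Real.Gamma (μ + 1) ≤ Real.Gamma (μ + k + 1) := by
  induction k with
  | zero => simp
  | succ k ih =>
    have hk : (0 : ℝ) ≤ k := k.cast_nonneg
    have h : Real.Gamma (μ + (k + 1 : ℕ) + 1) = (μ + k + 1) * Real.Gamma (μ + k + 1) := by
      rw [← Real.Gamma_add_one (by positivity)]
      push_cast
      ring_nf
    have hpos : 0 < Real.Gamma (μ + k + 1) := Real.Gamma_pos_of_pos (by positivity)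
    rw [h]
    nlinarith [mul_nonneg (add_nonneg hμ hk) hpos.le]

lemma summable_besselEntire {μ : ℝ} (hμ : 0 ≤ μ) (z : ℝ) :
    Summable fun k : ℕ => z ^ k / ((k.factorial : ℝ) * Real.Gamma (μ + k + 1)) := by
  have hG : 0 < Real.Gamma (μ + 1) := Real.Gamma_pos_of_pos (by positivity)
  refine Summable.of_norm_bounded
    ((Real.summable_pow_div_factorial |z|).mul_right (Real.Gamma (μ + 1))⁻¹) fun k => ?_
  have hk : 0 < Real.Gamma (μ + k + 1) := Real.Gamma_pos_of_pos (by positivity)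
  rw [norm_div, norm_pow, norm_mul, Real.norm_eq_abs, Real.norm_natCast, Real.norm_of_nonneg hk.le,
    ← div_eq_mul_inv, div_div]
  gcongr
  exact Gamma_le_Gamma_add_nat hμ k

lemma besselEntire_pos {μ z : ℝ} (hμ : 0 ≤ μ) (hz : 0 ≤ z) : 0 < besselEntire μ z := by
  have hG (k : ℕ) : 0 < Real.Gamma (μ + k + 1) := Real.Gamma_pos_of_pos (by positivity)
  refine (summable_besselEntire hμ z).tsum_pos (fun k => ?_) 0 ?_
  · have := hG k
    positivity
  · have := hG 0
    simp only [pow_zero]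
    positivity

lemma besselI_eq_rpow_mul {μ x : ℝ} (hx : 0 < x) :
    besselI μ x = (x / 2) ^ μ * besselEntire μ (x ^ 2 / 4) := by
  rw [besselI, besselEntire, ← tsum_mul_left]
  refine tsum_congr fun k => ?_
  rw [Real.rpow_add (by positivity), mul_div_assoc, show 2 * (k : ℝ) = ((2 * k : ℕ) : ℝ) by simp,
    Real.rpow_natCast, pow_mul]
  congr 3
  ring

lemma besselEntire_deriv_term (μ z : ℝ) (k : ℕ) :
    ((k + 1 : ℕ) : ℝ) * z ^ (k + 1 - 1) /
        (((k + 1).factorial : ℝ) * Real.Gamma (μ + (k + 1 : ℕ) + 1)) =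
      z ^ k / ((k.factorial : ℝ) * Real.Gamma (μ + 1 + k + 1)) := by
  rw [Nat.add_sub_cancel, Nat.factorial_succ]
  have h : μ + ((k + 1 : ℕ) : ℝ) + 1 = μ + 1 + k + 1 := by push_cast; ring
  rw [h]
  push_cast
  rw [mul_assoc, mul_div_mul_left]
  positivity

lemma summable_besselEntire_deriv {μ : ℝ} (hμ : 0 ≤ μ) (z : ℝ) :
    Summable fun k : ℕ =>
      (k : ℝ) * z ^ (k - 1) / ((k.factorial : ℝ) * Real.Gamma (μ + k + 1)) := by
  rw [← summable_nat_add_iff 1]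
  simp_rw [besselEntire_deriv_term]
  exact summable_besselEntire (by positivity) z

lemma tsum_besselEntire_deriv {μ : ℝ} (hμ : 0 ≤ μ) (z : ℝ) :
    ∑' k : ℕ, (k : ℝ) * z ^ (k - 1) / ((k.factorial : ℝ) * Real.Gamma (μ + k + 1)) =
      besselEntire (μ + 1) z := by
  rw [(summable_besselEntire_deriv hμ z).tsum_eq_zero_add]
  simp_rw [besselEntire_deriv_term]
  simp [besselEntire]

lemma hasDerivAt_besselEntire {μ : ℝ} (hμ : 0 ≤ μ) (z : ℝ) :
    HasDerivAt (besselEntire μ) (besselEntire (μ + 1) z) z := by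
  rw [← tsum_besselEntire_deriv hμ z]
  have hz : z ∈ Metric.ball (0 : ℝ) (|z| + 1) := by simp
  refine hasDerivAt_tsum_of_isPreconnected (summable_besselEntire_deriv hμ (|z| + 1))
    Metric.isOpen_ball (convex_ball (0 : ℝ) _).isPreconnected
    (fun k y _ => (hasDerivAt_pow k y).div_const _) (fun k y hy => ?_) hz
    (summable_besselEntire hμ z) hz
  have hk : 0 < Real.Gamma (μ + k + 1) := Real.Gamma_pos_of_pos (by positivity)
  have hy' : |y| ≤ |z| + 1 := by simpa using (Metric.mem_ball.1 hy).le
  rw [norm_div, norm_mul, norm_mul, norm_pow, Real.norm_eq_abs y, Real.norm_natCast,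
    Real.norm_natCast, Real.norm_of_nonneg hk.le]
  gcongr

lemma besselEntire_recurrence {μ : ℝ} (hμ : 0 ≤ μ) (z : ℝ) :
    besselEntire μ z =
      (μ + 1) * besselEntire (μ + 1) z + z * besselEntire (μ + 1 + 1) z := by
  have hμ' : 0 ≤ μ + 1 := by positivity
  rw [← tsum_besselEntire_deriv hμ' z, besselEntire, besselEntire, ← tsum_mul_left,
    ← tsum_mul_left, ← ((summable_besselEntire hμ' z).mul_left _).tsum_add
      ((summable_besselEntire_deriv hμ' z).mul_left _)]
  refine tsum_congr fun k => ?_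
  have hk : 0 < Real.Gamma (μ + k + 1) := Real.Gamma_pos_of_pos (by positivity)
  have h : Real.Gamma (μ + 1 + k + 1) = (μ + k + 1) * Real.Gamma (μ + k + 1) := by
    rw [← Real.Gamma_add_one (by positivity)]
    ring_nf
  have hpow : z * ((k : ℝ) * z ^ (k - 1)) = k * z ^ k := by
    rcases k with _ | k
    · simp
    · rw [Nat.add_sub_cancel, pow_succ]; ring
  have hne : μ + k + 1 ≠ 0 := by positivity
  rw [← mul_div_assoc z, hpow, h]
  field_simp
  ring

/-- A maximum principle for the singular equation `v f' = -a f + r`. -/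
lemma le_of_euler_ode {f f' a r : ℝ → ℝ} {V c M : ℝ} (hc : 0 < c)
    (hf : ∀ v ∈ Set.Icc 0 V, HasDerivAt f (f' v) v)
    (hode : ∀ v ∈ Set.Icc 0 V, v * f' v = -a v * f v + r v)
    (ha : ∀ v ∈ Set.Icc 0 V, c ≤ a v) (hr : ∀ v ∈ Set.Icc 0 V, |r v| ≤ M)
    {v : ℝ} (hv : v ∈ Set.Icc 0 V) : f v ≤ M / c := by
  obtain ⟨w, hw, hmax⟩ := isCompact_Icc.exists_isMaxOn ⟨v, hv⟩
    (fun y hy => (hf y hy).continuousAt.continuousWithinAt)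
  refine (hmax hv).trans ?_
  have hder : 0 ≤ w * f' w := by
    rcases hw.1.eq_or_lt with h0 | h0
    · simp [← h0]
    · have hl : IsLocalMaxOn f (Set.Icc 0 w) w :=
        (hmax.on_subset (Set.Icc_subset_Icc_right hw.2)).localize
      have hcone : (0 - w) ∈ posTangentConeAt (Set.Icc 0 w) w :=
        sub_mem_posTangentConeAt_of_segment_subset
          (by rw [segment_symm, segment_eq_Icc h0.le])
      have := hl.hasFDerivWithinAt_nonpos (hf w hw).hasFDerivAt.hasFDerivWithinAt hcone
      simp at this
      linarith
  rw [hode w hw] at hder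
  have h1 := ha w hw
  have h2 := (abs_le.1 (hr w hw)).2
  rw [le_div_iff₀ hc]
  rcases le_or_gt (f w) 0 with h | h
  · have := (abs_nonneg _).trans (hr w hw)
    nlinarith
  · nlinarith

lemma abs_le_of_euler_ode {f f' a r : ℝ → ℝ} {V c M : ℝ} (hc : 0 < c)
    (hf : ∀ v ∈ Set.Icc 0 V, HasDerivAt f (f' v) v)
    (hode : ∀ v ∈ Set.Icc 0 V, v * f' v = -a v * f v + r v)
    (ha : ∀ v ∈ Set.Icc 0 V, c ≤ a v) (hr : ∀ v ∈ Set.Icc 0 V, |r v| ≤ M)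
    {v : ℝ} (hv : v ∈ Set.Icc 0 V) : |f v| ≤ M / c := by
  refine abs_le'.2 ⟨le_of_euler_ode hc hf hode ha hr hv, ?_⟩
  refine le_of_euler_ode (f := fun v => -f v) (f' := fun v => -f' v) (r := fun v => -r v) hc
    (fun v hv => (hf v hv).neg) (fun v hv => ?_) ha (fun v hv => ?_) hv
  · linear_combination -hode v hv
  · simpa using hr v hv

/-- The ratio `I_{ν+1/2}(νu) / I_{ν-1/2}(νu)` at `v = u²`, divided by its limit
`u / (1 + √(1 + u²))`. -/
noncomputable def normalizedRatio (ν v : ℝ) : ℝ :=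
  (1 + √(1 + v)) / 2 *
    (ν * besselEntire (ν - 1 / 2 + 1) (ν ^ 2 / 4 * v) / besselEntire (ν - 1 / 2) (ν ^ 2 / 4 * v))

lemma normalizedRatio_pos {ν v : ℝ} (hν : 1 / 2 ≤ ν) (hv : 0 ≤ v) : 0 < normalizedRatio ν v := by
  have h1 := besselEntire_pos (μ := ν - 1 / 2) (z := ν ^ 2 / 4 * v) (by linarith) (by positivity)
  have h2 := besselEntire_pos (μ := ν - 1 / 2 + 1) (z := ν ^ 2 / 4 * v) (by linarith)
    (by positivity)
  have : 0 < ν := by linarith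
  rw [normalizedRatio]
  positivity

lemma hasDerivAt_sqrt_one_add {v : ℝ} (hv : 0 ≤ v) :
    HasDerivAt (fun v => √(1 + v)) (1 / (2 * √(1 + v))) v :=
  ((hasDerivAt_id v).const_add 1).sqrt (by simp; positivity)

lemma exists_hasDerivAt_normalizedRatio {ν v : ℝ} (hν : 1 / 2 ≤ ν) (hv : 0 ≤ v) :
    ∃ d, HasDerivAt (normalizedRatio ν) d v ∧
      v * (2 * d) = -(√(1 + v))⁻¹ * normalizedRatio ν v +
        ν * (1 + √(1 + v) - (√(1 + v) - 1) * normalizedRatio ν v ^ 2 -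
          2 * normalizedRatio ν v) := by
  have hμ : 0 ≤ ν - 1 / 2 := by linarith
  have hν0 : 0 < ν := by linarith
  have hlin : HasDerivAt (fun v : ℝ => ν ^ 2 / 4 * v) (ν ^ 2 / 4) v := by
    simpa using (hasDerivAt_id v).const_mul (ν ^ 2 / 4)
  have h0 := (hasDerivAt_besselEntire hμ (ν ^ 2 / 4 * v)).comp v hlin
  have h1 := (hasDerivAt_besselEntire (μ := ν - 1 / 2 + 1) (by linarith)
    (ν ^ 2 / 4 * v)).comp v hlin
  have hpos := besselEntire_pos hμ (z := ν ^ 2 / 4 * v) (by positivity)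
  have hrec := besselEntire_recurrence hμ (ν ^ 2 / 4 * v)
  refine ⟨_, (((hasDerivAt_sqrt_one_add hv).const_add 1).div_const 2).mul
    ((h1.const_mul ν).div h0 hpos.ne'), ?_⟩
  have hs : 0 < √(1 + v) := by positivity
  have hs2 : √(1 + v) ^ 2 = 1 + v := Real.sq_sqrt (by positivity)
  simp only [normalizedRatio, Function.comp_apply]
  generalize besselEntire (ν - 1 / 2) (ν ^ 2 / 4 * v) = a at *
  generalize besselEntire (ν - 1 / 2 + 1) (ν ^ 2 / 4 * v) = b at *
  generalize besselEntire (ν - 1 / 2 + 1 + 1) (ν ^ 2 / 4 * v) = c at *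
  generalize √(1 + v) = s at *
  obtain rfl : v = s ^ 2 - 1 := by linarith
  field_simp
  linear_combination -16 * a * s * (1 + s) * hrec

/-- The expansion of `normalizedRatio ν v` to third order in `e = 1/ν`, with `t = (1+v)^(-1/2)`. -/
noncomputable def ratioExpansion (e t : ℝ) : ℝ :=
  1 + e * (-t ^ 2 / 2 + e * (-t ^ 3 / 2 + t ^ 4 / 8 + 5 * t ^ 5 / 8) +
    e ^ 2 * (-3 * t ^ 4 / 4 + t ^ 5 / 4 + 41 * t ^ 6 / 16 - 5 * t ^ 7 / 16 - 15 * t ^ 8 / 8))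

/-- The `t`-derivative of `ratioExpansion e`. -/
noncomputable def ratioExpansionDeriv (e t : ℝ) : ℝ :=
  e * (-t + e * (-3 * t ^ 2 / 2 + t ^ 3 / 2 + 25 * t ^ 4 / 8) +
    e ^ 2 * (-3 * t ^ 3 + 5 * t ^ 4 / 4 + 123 * t ^ 5 / 8 - 35 * t ^ 6 / 16 - 15 * t ^ 7))

lemma hasDerivAt_ratioExpansion (e t : ℝ) :
    HasDerivAt (ratioExpansion e) (ratioExpansionDeriv e t) t := by
  have hp (n : ℕ) := hasDerivAt_pow n t
  have h := ((((((hp 2).neg.div_const 2).add (((((hp 3).neg.div_const 2).add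
    ((hp 4).div_const 8)).add (((hp 5).const_mul 5).div_const 8)).const_mul e)).add
    (((((((hp 4).const_mul (-3)).div_const 4).add ((hp 5).div_const 4)).add
    (((hp 6).const_mul 41).div_const 16)).sub (((hp 7).const_mul 5).div_const 16)).sub
    (((hp 8).const_mul 15).div_const 8) |>.const_mul (e ^ 2))).const_mul e).const_add 1)
  refine h.congr_deriv ?_
  rw [ratioExpansionDeriv]
  push_cast
  ring

lemma exists_abs_le_of_continuous_unit_square {f : ℝ → ℝ → ℝ}
    (hf : Continuous fun p : ℝ × ℝ => f p.1 p.2) :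
    ∃ C, 0 < C ∧ ∀ e ∈ Set.Icc (0 : ℝ) 1, ∀ t ∈ Set.Icc (0 : ℝ) 1, |f e t| ≤ C := by
  obtain ⟨C, hC⟩ := (isCompact_Icc.prod isCompact_Icc :
    IsCompact (Set.Icc (0 : ℝ) 1 ×ˢ Set.Icc (0 : ℝ) 1)).exists_bound_of_continuousOn hf.continuousOn
  exact ⟨max C 1, by positivity, fun e he t ht => (hC (e, t) ⟨he, ht⟩).trans (le_max_left _ _)⟩

lemma exists_ratioExpansion_residual_bound :
    ∃ C, 0 < C ∧ ∀ e ∈ Set.Icc (0 : ℝ) 1, ∀ t ∈ Set.Icc (0 : ℝ) 1,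
      |(1 - ratioExpansion e t) * (1 + t + (1 - t) * ratioExpansion e t) -
        e * (t ^ 2 * ratioExpansion e t - (1 - t ^ 2) * t ^ 2 * ratioExpansionDeriv e t)| ≤
      C * e ^ 4 := by
  obtain ⟨C, hC, h⟩ := exists_abs_le_of_continuous_unit_square
    (f := fun e t =>
      -3 * t ^ 5 + t ^ 6 + 39 * t ^ 7 / 2 - 205 * t ^ 8 / 64 - 2157 * t ^ 9 / 64 + 145
      * t ^ 10 / 64 + 1105 * t ^ 11 / 64 + e * (-3 * t ^ 7 / 4 + 19 * t ^ 8 / 16 + 3 *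
      t ^ 9 - 301 * t ^ 10 / 64 - 239 * t ^ 11 / 64 + 375 * t ^ 12 / 64 + 95 * t ^ 13
      / 64 - 75 * t ^ 14 / 32) + e ^ 2 * (-9 * t ^ 8 / 16 + 15 * t ^ 9 / 16 + 109 * t
      ^ 10 / 32 - 177 * t ^ 11 / 32 - 1913 * t ^ 12 / 256 + 3011 * t ^ 13 / 256 + 1785 *
      t ^ 14 / 256 - 2735 * t ^ 15 / 256 - 75 * t ^ 16 / 32 + 225 * t ^ 17 / 64)) (by fun_prop)
  refine ⟨C, hC, fun e he t ht => ?_⟩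
  have he4 : 0 ≤ e ^ 4 := by have := he.1; positivity
  refine le_of_eq_of_le ?_ (mul_le_mul_of_nonneg_right (h e he t ht) he4)
  rw [← abs_of_nonneg he4, ← abs_mul]
  simp only [ratioExpansion, ratioExpansionDeriv]
  congr 1
  ring

lemma exists_ratioExpansion_cosh_bound :
    ∃ C, 0 < C ∧ ∀ e ∈ Set.Icc (0 : ℝ) 1, ∀ t ∈ Set.Icc (0 : ℝ) 1,
      |((1 - t) * ratioExpansion e t ^ 2 + (1 + t)) / 2 - ratioExpansion e t *
        (1 + e * (t ^ 3 / 2) + e ^ 2 * (5 / 8 * t ^ 4 * (1 - t ^ 2)) +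
          e ^ 3 * (t ^ 5 * (1 - 23 / 8 * t ^ 2 + 15 / 8 * t ^ 4)))| ≤ C * e ^ 4 := by
  obtain ⟨C, hC, h⟩ := exists_abs_le_of_continuous_unit_square
    (f := fun e t =>
      t ^ 6 / 2 + t ^ 7 / 2 - 205 * t ^ 8 / 128 - 205 * t ^ 9 / 128 + 145 * t ^ 10 /
      128 + 145 * t ^ 11 / 128 + e * (3 * t ^ 7 / 8 + 3 * t ^ 8 / 8 - 57 * t ^ 9 / 32
      - 57 * t ^ 10 / 32 + 165 * t ^ 11 / 64 + 165 * t ^ 12 / 64 - 75 * t ^ 13 / 64 - 75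
      * t ^ 14 / 64) + e ^ 2 * (9 * t ^ 8 / 32 + 9 * t ^ 9 / 32 - 125 * t ^ 10 / 64 -
      125 * t ^ 11 / 64 + 2441 * t ^ 12 / 512 + 2441 * t ^ 13 / 512 - 2485 * t ^ 14 /
      512 - 2485 * t ^ 15 / 512 + 225 * t ^ 16 / 128 + 225 * t ^ 17 / 128)) (by fun_prop)
  refine ⟨C, hC, fun e he t ht => ?_⟩
  have he4 : 0 ≤ e ^ 4 := by have := he.1; positivity
  refine le_of_eq_of_le ?_ (mul_le_mul_of_nonneg_right (h e he t ht) he4)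
  rw [← abs_of_nonneg he4, ← abs_mul]
  simp only [ratioExpansion]
  congr 1
  ring

lemma exists_half_le_ratioExpansion :
    ∃ e₀, 0 < e₀ ∧ e₀ ≤ 1 ∧ ∀ e ∈ Set.Icc (0 : ℝ) e₀, ∀ t ∈ Set.Icc (0 : ℝ) 1,
      1 / 2 ≤ ratioExpansion e t := by
  obtain ⟨C, hC, h⟩ := exists_abs_le_of_continuous_unit_square
    (f := fun e t => -t ^ 2 / 2 + e * (-t ^ 3 / 2 + t ^ 4 / 8 + 5 * t ^ 5 / 8) +
      e ^ 2 * (-3 * t ^ 4 / 4 + t ^ 5 / 4 + 41 * t ^ 6 / 16 - 5 * t ^ 7 / 16 -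
        15 * t ^ 8 / 8)) (by fun_prop)
  refine ⟨min 1 (1 / (2 * C)), by positivity, min_le_left _ _, fun e he t ht => ?_⟩
  have hb := (abs_le.1 (h e ⟨he.1, he.2.trans (min_le_left _ _)⟩ t ht)).1
  have he2 : e * C ≤ 1 / 2 := by
    have := (le_div_iff₀ (by positivity)).1 (he.2.trans (min_le_right _ _))
    linarith
  have := mul_le_mul_of_nonneg_left hb he.1
  simp only [ratioExpansion] at this ⊢
  linarith

/-- `normalizedRatio` agrees with its expansion to fourth order, at each fixed argument. -/
lemma exists_normalizedRatio_sub_expansion_bound (V : ℝ) (hV : 0 ≤ V) :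
    ∃ C N, ∀ ν, N ≤ ν →
      |normalizedRatio ν V - ratioExpansion ν⁻¹ (√(1 + V))⁻¹| ≤ C * ν⁻¹ ^ 4 := by
  obtain ⟨C, hC, hres⟩ := exists_ratioExpansion_residual_bound
  obtain ⟨e₀, he₀, he₁, hhalf⟩ := exists_half_le_ratioExpansion
  refine ⟨√(1 + V) * C / 2, e₀⁻¹, fun ν hν => ?_⟩
  have hν1 : 1 ≤ ν := ((one_le_inv₀ he₀).2 he₁).trans hν
  have hν0 : 0 < ν := by linarith
  have heν : ν⁻¹ ≤ e₀ := inv_le_of_inv_le₀ he₀ hν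
  have hemem : ν⁻¹ ∈ Set.Icc (0 : ℝ) e₀ := ⟨by positivity, heν⟩
  have hemem1 : ν⁻¹ ∈ Set.Icc (0 : ℝ) 1 := ⟨by positivity, heν.trans he₁⟩
  have hs (v : ℝ) (hv : 0 ≤ v) : 1 ≤ √(1 + v) := Real.one_le_sqrt.2 (by linarith)
  have htmem (v : ℝ) (hv : 0 ≤ v) : (√(1 + v))⁻¹ ∈ Set.Icc (0 : ℝ) 1 :=
    ⟨by positivity, inv_le_one_of_one_le₀ (hs v hv)⟩
  choose! d hd hode using fun v (hv : 0 ≤ v) =>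
    exists_hasDerivAt_normalizedRatio (ν := ν) (by linarith) hv
  have hdA (v : ℝ) (hv : 0 ≤ v) := (hasDerivAt_ratioExpansion ν⁻¹ (√(1 + v))⁻¹).comp v
    ((hasDerivAt_sqrt_one_add hv).inv (by have := hs v hv; positivity))
  have key := abs_le_of_euler_ode (V := V) (c := ν) (M := ν * √(1 + V) * (C * ν⁻¹ ^ 4))
    (f := fun v => 2 * (normalizedRatio ν v - ratioExpansion ν⁻¹ (√(1 + v))⁻¹))
    (a := fun v => ((√(1 + v))⁻¹ + 2 * ν +
      ν * (√(1 + v) - 1) * (normalizedRatio ν v + ratioExpansion ν⁻¹ (√(1 + v))⁻¹)) / 2)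
    (r := fun v => ν * √(1 + v) * ((1 - ratioExpansion ν⁻¹ (√(1 + v))⁻¹) * (1 + (√(1 + v))⁻¹ +
      (1 - (√(1 + v))⁻¹) * ratioExpansion ν⁻¹ (√(1 + v))⁻¹) -
      ν⁻¹ * ((√(1 + v))⁻¹ ^ 2 * ratioExpansion ν⁻¹ (√(1 + v))⁻¹ -
        (1 - (√(1 + v))⁻¹ ^ 2) * (√(1 + v))⁻¹ ^ 2 * ratioExpansionDeriv ν⁻¹ (√(1 + v))⁻¹)))
    hν0 (fun v hv => ((hd v hv.1).sub (hdA v hv.1)).const_mul 2)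
    (fun v hv => ?_) (fun v hv => ?_) (fun v hv => ?_) (Set.right_mem_Icc.2 hV)
  · have hbound : ν * √(1 + V) * (C * ν⁻¹ ^ 4) / ν = √(1 + V) * C * ν⁻¹ ^ 4 := by
      field_simp
    rw [abs_mul, abs_two, hbound] at key
    linarith
  · have hs2 : √(1 + v) ^ 2 = 1 + v := Real.sq_sqrt (by linarith [hv.1])
    have hs1 := hs v hv.1
    have hv' : v = √(1 + v) ^ 2 - 1 := by linarith
    have hode' := hode v hv.1
    generalize ratioExpansion ν⁻¹ (√(1 + v))⁻¹ = A at *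
    generalize ratioExpansionDeriv ν⁻¹ (√(1 + v))⁻¹ = A' at *
    generalize normalizedRatio ν v = G at *
    rw [mul_sub, mul_sub, hode']
    generalize √(1 + v) = s at *
    have hs0 : 0 < s := by linarith
    rw [hv']
    field_simp
    ring
  · have h1 := hhalf _ hemem _ (htmem v hv.1)
    have h2 := normalizedRatio_pos (ν := ν) (by linarith) hv.1
    have h3 := (htmem v hv.1).1
    have h4 := hs v hv.1
    have : 0 ≤ ν * (√(1 + v) - 1) * (normalizedRatio ν v + ratioExpansion ν⁻¹ (√(1 + v))⁻¹) :=
      mul_nonneg (mul_nonneg hν0.le (by linarith)) (by linarith)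
    linarith
  · have h1 := hres _ hemem1 _ (htmem v hv.1)
    rw [abs_mul, abs_of_nonneg (by positivity : 0 ≤ ν * √(1 + v))]
    have := hv.2
    gcongr

/-- The Bessel quotient is `u G / (1 + √(1+u²))` with `G = normalizedRatio ν (u²)`. -/
lemma besselI_div_besselI_eq {ν u : ℝ} (hν : 1 / 2 ≤ ν) (hu : 0 < u) :
    besselI (ν + 1 / 2) (ν * u) / besselI (ν - 1 / 2) (ν * u) =
      u * normalizedRatio ν (u ^ 2) / (1 + √(1 + u ^ 2)) := by
  have hν0 : 0 < ν := by linarith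
  have hpos := besselEntire_pos (μ := ν - 1 / 2) (z := ν ^ 2 / 4 * u ^ 2) (by linarith)
    (by positivity)
  have hz : (ν * u) ^ 2 / 4 = ν ^ 2 / 4 * u ^ 2 := by ring
  have hp : (0 : ℝ) < (ν * u / 2) ^ (ν - 1 / 2) := by positivity
  rw [besselI_eq_rpow_mul (by positivity), besselI_eq_rpow_mul (by positivity), hz,
    show ν + 1 / 2 = ν - 1 / 2 + 1 by ring, Real.rpow_add_one (by positivity), normalizedRatio]
  have hs : 0 < 1 + √(1 + u ^ 2) := by positivity
  field_simp

/-- The symmetrized quotient in terms of the normalized ratio. -/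
lemma symmetrized_quotient_eq {u s G : ℝ} (hu : 0 < u) (hs : 0 < s) (hs2 : s ^ 2 = 1 + u ^ 2)
    (hG : 0 < G) :
    u / (2 * s) * (u * G / (1 + s) + (u * G / (1 + s))⁻¹) =
      ((1 - s⁻¹) * G + (1 + s⁻¹) / G) / 2 := by
  have hu2 : u ^ 2 = (s - 1) * (1 + s) := by linarith
  have hs1 : 0 < 1 + s := by linarith
  have h1 : u * (u * G / (1 + s)) = (s - 1) * G := by
    rw [← mul_div_assoc, ← mul_assoc, ← sq, hu2]
    field_simp
  have h2 : u * (u * G / (1 + s))⁻¹ = (1 + s) / G := by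
    field_simp
  calc u / (2 * s) * (u * G / (1 + s) + (u * G / (1 + s))⁻¹)
      = (u * (u * G / (1 + s)) + u * (u * G / (1 + s))⁻¹) / (2 * s) := by ring
    _ = _ := by rw [h1, h2]; field_simp; ring

theorem symmetrized_quotient_isBigO (u t : ℝ) (hu : 0 < u)
    (ht : t = (1 + u ^ 2) ^ (-(1 / 2) : ℝ)) :
    (fun ν : ℝ =>
        u / (2 * Real.sqrt (1 + u ^ 2)) *
            (besselI (ν + 1 / 2) (ν * u) / besselI (ν - 1 / 2) (ν * u) +
              besselI (ν - 1 / 2) (ν * u) / besselI (ν + 1 / 2) (ν * u)) -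
          (1 + 1 / ν * (t ^ 3 / 2) + 1 / ν ^ 2 * (5 / 8 * t ^ 4 * (1 - t ^ 2)) +
            1 / ν ^ 3 * (t ^ 5 * (1 - 23 / 8 * t ^ 2 + 15 / 8 * t ^ 4))))
      =O[atTop] fun ν : ℝ => ν ^ (-(4 : ℝ)) := by
  have hts : t = (√(1 + u ^ 2))⁻¹ := by
    rw [ht, Real.rpow_neg (by positivity), ← Real.sqrt_eq_rpow]
  have hs : 1 ≤ √(1 + u ^ 2) := Real.one_le_sqrt.2 (by nlinarith)
  have ht01 : t ∈ Set.Icc (0 : ℝ) 1 := by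
    rw [hts]; exact ⟨by positivity, inv_le_one_of_one_le₀ hs⟩
  obtain ⟨C, N, hC⟩ := exists_normalizedRatio_sub_expansion_bound (u ^ 2) (by positivity)
  obtain ⟨K, hcosh_pos, hcosh⟩ := exists_ratioExpansion_cosh_bound
  obtain ⟨e₀, he₀, he₁, hhalf⟩ := exists_half_le_ratioExpansion
  refine Asymptotics.IsBigO.of_bound (9 * |C| + 2 * K) ?_
  filter_upwards [eventually_ge_atTop N, eventually_ge_atTop e₀⁻¹,
    eventually_ge_atTop (4 * |C|), eventually_ge_atTop 1] with ν hN hν hνC hν1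
  have hν0 : 0 < ν := by linarith
  have he1 : ν⁻¹ ≤ 1 := inv_le_one_of_one_le₀ hν1
  have he0 : 0 ≤ ν⁻¹ := by positivity
  have hGA := hC ν hN
  have hA := hhalf _ ⟨he0, inv_le_of_inv_le₀ he₀ hν⟩ t ht01
  have hT := hcosh _ ⟨he0, he1⟩ t ht01
  have hGpos := normalizedRatio_pos (ν := ν) (v := u ^ 2) (by linarith) (by positivity)
  rw [← hts] at hGA
  have hpow : ν ^ (-(4 : ℝ)) = ν⁻¹ ^ 4 := by
    rw [Real.rpow_neg hν0.le, inv_pow]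
    norm_cast
  have hquot := besselI_div_besselI_eq (ν := ν) (by linarith) hu
  rw [← inv_div (besselI (ν + 1 / 2) (ν * u)), hquot, symmetrized_quotient_eq hu (by positivity)
    (Real.sq_sqrt (by positivity)) hGpos, ← hts, hpow, one_div, one_div, one_div, ← inv_pow,
    ← inv_pow, Real.norm_eq_abs, Real.norm_of_nonneg (by positivity)]
  have hsmall : |C| * ν⁻¹ ^ 4 ≤ 1 / 4 := by
    have h1 : ν⁻¹ ^ 4 ≤ ν⁻¹ := pow_le_of_le_one he0 he1 (by norm_num)
    have h2 : |C| * ν⁻¹ ≤ 1 / 4 := by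
      rw [← div_eq_mul_inv, div_le_iff₀ hν0]
      linarith
    exact (mul_le_mul_of_nonneg_left h1 (abs_nonneg C)).trans h2
  have hE : 0 ≤ ν⁻¹ ^ 4 := by positivity
  replace hGA := hGA.trans (mul_le_mul_of_nonneg_right (le_abs_self C) hE)
  have hG4 : 1 / 4 ≤ normalizedRatio ν (u ^ 2) := by
    have := (abs_le.1 (hGA.trans hsmall)).1
    linarith
  generalize normalizedRatio ν (u ^ 2) = G at *
  generalize ratioExpansion ν⁻¹ t = A at *
  generalize 1 + ν⁻¹ * (t ^ 3 / 2) + ν⁻¹ ^ 2 * (5 / 8 * t ^ 4 * (1 - t ^ 2)) +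
    ν⁻¹ ^ 3 * (t ^ 5 * (1 - 23 / 8 * t ^ 2 + 15 / 8 * t ^ 4)) = T at *
  generalize ν⁻¹ ^ 4 = E at *
  have hA0 : 0 < A := by linarith
  have hdecomp : ((1 - t) * G + (1 + t) / G) / 2 - T =
      (1 - t) / 2 * (G - A) - (1 + t) / 2 / (G * A) * (G - A) +
        (((1 - t) * A ^ 2 + (1 + t)) / 2 - A * T) / A := by
    field_simp
    ring
  have h1 : |(1 - t) / 2 * (G - A)| ≤ 1 * (|C| * E) := by
    rw [abs_mul]
    gcongr
    rw [abs_le]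
    constructor <;> linarith [ht01.1, ht01.2]
  have h2 : |(1 + t) / 2 / (G * A) * (G - A)| ≤ 8 * (|C| * E) := by
    have ht0 := ht01.1
    rw [abs_mul]
    gcongr
    rw [abs_of_nonneg (by positivity), div_le_iff₀ (by positivity)]
    nlinarith [ht01.2]
  have h3 : |(((1 - t) * A ^ 2 + (1 + t)) / 2 - A * T) / A| ≤ 2 * (K * E) := by
    rw [abs_div, abs_of_pos hA0, div_le_iff₀ hA0]
    nlinarith [mul_nonneg hcosh_pos.le hE]
  rw [hdecomp]
  calc _ ≤ |(1 - t) / 2 * (G - A)| + |(1 + t) / 2 / (G * A) * (G - A)| +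
        |(((1 - t) * A ^ 2 + (1 + t)) / 2 - A * T) / A| :=
        (abs_add_le _ _).trans (add_le_add_left (abs_sub _ _) _)
    _ ≤ _ := by linarith

/-- with `t = (1+u²)^{−1/2}`, as `ν → ∞`,
`(u/(2√(1+u²)))[I_{ν+1/2}(νu)/I_{ν−1/2}(νu) + I_{ν−1/2}(νu)/I_{ν+1/2}(νu)]
 = 1 + t³/(2ν) + (5/8)t⁴(1−t²)/ν² + t⁵(1 − (23/8)t² + (15/8)t⁴)/ν³ + O(ν^{−4})`;
equivalently, for `θ ≠ 0`, `P_ν(θ, νu) = b(1 + δ(ν))` with `b = √(1+u²)/(u sinh θ)`. -/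
theorem stmt_16 (u t : ℝ) (hu : 0 < u) (ht : t = (1 + u ^ 2) ^ (-(1 / 2) : ℝ)) :
    ((fun ν : ℝ =>
        u / (2 * Real.sqrt (1 + u ^ 2)) *
            (besselI (ν + 1 / 2) (ν * u) / besselI (ν - 1 / 2) (ν * u) +
              besselI (ν - 1 / 2) (ν * u) / besselI (ν + 1 / 2) (ν * u)) -
          (1 + 1 / ν * (t ^ 3 / 2) + 1 / ν ^ 2 * (5 / 8 * t ^ 4 * (1 - t ^ 2)) +
            1 / ν ^ 3 * (t ^ 5 * (1 - 23 / 8 * t ^ 2 + 15 / 8 * t ^ 4))))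
      =O[atTop] fun ν : ℝ => ν ^ (-(4 : ℝ))) ∧
    (∀ θ : ℝ, θ ≠ 0 →
      (fun ν : ℝ =>
          1 / (2 * Real.sinh θ) *
              (besselI (ν + 1 / 2) (ν * u) / besselI (ν - 1 / 2) (ν * u) +
                besselI (ν - 1 / 2) (ν * u) / besselI (ν + 1 / 2) (ν * u)) -
            Real.sqrt (1 + u ^ 2) / (u * Real.sinh θ) *
              (1 + t ^ 3 / (2 * ν) + 5 / 8 * t ^ 4 * (1 - t ^ 2) / ν ^ 2 +
                t ^ 5 * (1 - 23 / 8 * t ^ 2 + 15 / 8 * t ^ 4) / ν ^ 3))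
        =O[atTop] fun ν : ℝ => ν ^ (-(4 : ℝ))) := by
  have h := symmetrized_quotient_isBigO u t hu ht
  refine ⟨h, fun θ hθ => ?_⟩
  refine (h.const_mul_left (√(1 + u ^ 2) / (u * Real.sinh θ))).congr_left fun ν => ?_
  have hs : √(1 + u ^ 2) ≠ 0 := by positivity
  have hsinh : Real.sinh θ ≠ 0 := Real.sinh_ne_zero.2 hθ
  rw [mul_sub, ← mul_assoc, div_mul_div_comm]
  congr 1
  · congr 1
    field_simp
  · ring
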